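/- Let Δ be a matroid on [s] of dimension s−1−c, let n ≥ c, and let f_1,…,f_s ∈ R = k[x_0,…,x_n] be homogeneous polynomials such that every subset of at most c+1 of them is an R-regular sequence. Then for every i ≥ 0, dim_k Tor_i^R(R/φ_*(I_Δ), k) = dim_k Tor_i^S(S/I_Δ, k); equivalently, if F is a graded minimal free resolution of S/I_Δ over S, then F ⊗_S R (via φ) is a graded minimal free resolution of R/φ_*(I_Δ) over R. -/

import Mathlib

/- ------------------------------------------------------------------
   Common definitions
------------------------------------------------------------------ -/

open MvPolynomial CategoryTheory

noncomputable section

/-- The height of an ideal: the infimum of the heights of the prime ideals containing it. -/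
noncomputable def idealHeight {A : Type*} [CommRing A] (I : Ideal A) : ℕ∞ :=
  ⨅ P ∈ {P : PrimeSpectrum A | I ≤ P.asIdeal}, Order.height P

/-- The depth of a module `M` with respect to an ideal `J`: the supremum of the lengths of
`M`-regular sequences consisting of elements of `J`. -/
noncomputable def idealDepth {A : Type*} [CommRing A] (J : Ideal A)
    (M : Type*) [AddCommGroup M] [Module A M] : ℕ∞ :=
  sSup {n : ℕ∞ | ∃ rs : List A, (rs.length : ℕ∞) = n ∧ (∀ r ∈ rs, r ∈ J) ∧
    RingTheory.Sequence.IsRegular M rs}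

/-- The irrelevant maximal ideal `(x_i : i ∈ σ)` of the polynomial ring `k[x_i : i ∈ σ]`. -/
def irrelevantIdeal (k : Type) [Field k] (σ : Type) : Ideal (MvPolynomial σ k) :=
  Ideal.span (Set.range (X : σ → MvPolynomial σ k))

/-- The quotient of a polynomial ring by an ideal `I` is Cohen–Macaulay if its depth with
respect to the irrelevant maximal ideal equals its Krull dimension. -/
def IsCMQuotient {k : Type} [Field k] {σ : Type} (I : Ideal (MvPolynomial σ k)) : Prop :=
  (idealDepth (irrelevantIdeal k σ) (MvPolynomial σ k ⧸ I) : WithBot ℕ∞)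
    = ringKrullDim (MvPolynomial σ k ⧸ I)

/-- An ideal of a polynomial ring is homogeneous if it contains all homogeneous components
of each of its elements. -/
def IsHomogeneousIdeal {k : Type} [Field k] {σ : Type} (I : Ideal (MvPolynomial σ k)) : Prop :=
  ∀ p ∈ I, ∀ i : ℕ, homogeneousComponent i p ∈ I

/-- The Hilbert function of `R/I`, `t ↦ dim_k [R/I]_t`, as a function `ℤ → ℤ`
(equal to `0` in negative degrees). -/
noncomputable def hilbertFn (k : Type) [Field k] {σ : Type} (I : Ideal (MvPolynomial σ k))
    (t : ℤ) : ℤ :=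
  if t < 0 then 0
  else
    (Module.finrank k (homogeneousSubmodule σ k t.toNat) : ℤ) -
    (Module.finrank k
      ((Submodule.restrictScalars k (I : Submodule (MvPolynomial σ k) (MvPolynomial σ k))) ⊓
        homogeneousSubmodule σ k t.toNat : Submodule k (MvPolynomial σ k)) : ℤ)

/-- `P` is the Hilbert polynomial of `R/I` if it agrees with the Hilbert function of `R/I`
in all sufficiently large degrees. -/
def IsHilbertPolyOf (k : Type) [Field k] {σ : Type} (I : Ideal (MvPolynomial σ k))
    (P : Polynomial ℚ) : Prop :=
  ∃ N : ℤ, ∀ t : ℤ, N ≤ t → (hilbertFn k I t : ℚ) = P.eval (t : ℚ)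

open Classical in
/-- The Hilbert polynomial of `R/I` (defined as `0` if none exists). -/
noncomputable def hilbertPoly (k : Type) [Field k] {σ : Type} (I : Ideal (MvPolynomial σ k)) :
    Polynomial ℚ :=
  if h : ∃ P : Polynomial ℚ, IsHilbertPolyOf k I P then h.choose else 0

/-- The multiplicity (degree) `e(R/I)`: `(δ-1)!` times the leading coefficient of the Hilbert
polynomial of `R/I`, whose degree is `δ - 1` where `δ = dim R/I ≥ 1`. -/
noncomputable def multiplicityDeg (k : Type) [Field k] {σ : Type}
    (I : Ideal (MvPolynomial σ k)) : ℚ :=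
  (Nat.factorial (hilbertPoly k I).natDegree) * (hilbertPoly k I).leadingCoeff

/-- The `m`-th symbolic power of an ideal `J`:
`J^{(m)} = ⋂_{P ∈ Ass(A/J)} (J^m A_P ∩ A)`. -/
noncomputable def symbolicPower {A : Type*} [CommRing A] (J : Ideal A) (m : ℕ) : Ideal A :=
  sInf { K : Ideal A | ∃ (P : Ideal A) (hP : IsAssociatedPrime P (A ⧸ J)),
    K = Ideal.comap (algebraMap A (Localization (@Ideal.primeCompl A _ P hP.1)))
          (Ideal.map (algebraMap A (Localization (@Ideal.primeCompl A _ P hP.1))) (J ^ m)) }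

/-- `α(I)`: the least degree of a nonzero form in `I`. -/
noncomputable def alphaDeg (k : Type) [Field k] {σ : Type} (I : Ideal (MvPolynomial σ k)) : ℕ :=
  sInf {d : ℕ | ∃ p ∈ I, p ≠ 0 ∧ MvPolynomial.IsHomogeneous p d}

/-- `dim_k Tor_i^A(M, N)`, the rank over the base field `k` of the Tor module. -/
noncomputable def torRank (k : Type) [Field k] (A : Type) [CommRing A] [Algebra k A]
    (M N : Type) [AddCommGroup M] [Module A M] [AddCommGroup N] [Module A N] (i : ℕ) :
    Cardinal :=
  Module.rank k (RestrictScalars k A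
    (((Tor (ModuleCat A) i).obj (ModuleCat.of A M)).obj (ModuleCat.of A N)))

/-- The `i`-th total Betti number `dim_k Tor_i(S/I, k)` of `S/I`, where
`k = S/(x_i : i ∈ σ)`. -/
noncomputable def bettiNum (k : Type) [Field k] {σ : Type} (I : Ideal (MvPolynomial σ k))
    (i : ℕ) : Cardinal :=
  torRank k (MvPolynomial σ k) (MvPolynomial σ k ⧸ I)
    (MvPolynomial σ k ⧸ irrelevantIdeal k σ) i

/-- The first map `I_S → I_C ⊕ I_S`, `g ↦ (g, f·g)`, of the basic double linkage sequence. -/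
def bdlFirstMap {A : Type*} [CommRing A] {I_S I_C : Ideal A} (h : I_S ≤ I_C) (f : A) :
    I_S →ₗ[A] I_C × I_S :=
  LinearMap.prod (Submodule.inclusion h) (f • LinearMap.id)

/-- The second map `I_C ⊕ I_S → f·I_C + I_S`, `(a, b) ↦ f·a - b`, of the basic double
linkage sequence. -/
def bdlSecondMap {A : Type*} [CommRing A] (I_C I_S : Ideal A) (f : A) :
    I_C × I_S →ₗ[A] ↥(Ideal.span {f} * I_C + I_S) :=
  LinearMap.coprod
    (LinearMap.codRestrict ((Ideal.span {f} * I_C + I_S : Ideal A) : Submodule A A)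
      (f • (Submodule.subtype (I_C : Submodule A A)))
      (fun c => Submodule.mem_sup_left
        (Ideal.mul_mem_mul (Ideal.mem_span_singleton_self f) c.2)))
    (- LinearMap.codRestrict ((Ideal.span {f} * I_C + I_S : Ideal A) : Submodule A A)
      (Submodule.subtype (I_S : Submodule A A))
      (fun c => Submodule.mem_sup_right c.2))

/-- The ideal `I_{V_{λ,c}}` of the codimension-`c` configuration determined by `f_1, …, f_s`:
the intersection of the ideals `(f_{i_1}, …, f_{i_c})` over all `c`-subsets. -/
def configIdeal {A : Type*} [CommRing A] {s : ℕ} (c : ℕ) (f : Fin s → A) : Ideal A :=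
  ⨅ T ∈ {T : Finset (Fin s) | T.card = c}, Ideal.span (f '' ↑T)

/-- Every sublist of at most `m` of the elements `f 1, …, f s` (in any order, without
repetitions) is a regular sequence. -/
def SubsetsRegular {A : Type*} [CommRing A] {s : ℕ} (f : Fin s → A) (m : ℕ) : Prop :=
  ∀ l : List (Fin s), l.Nodup → l.length ≤ m →
    RingTheory.Sequence.IsRegular A (l.map f)

/-- `Δ` is (the independence complex of) a matroid on `{1, …, s}`: a nonempty collection of
subsets closed under inclusion and satisfying the augmentation axiom. -/
def IsMatroid {s : ℕ} (Δ : Finset (Fin s) → Prop) : Prop :=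
  Δ ∅ ∧ (∀ F G : Finset (Fin s), Δ F → G ⊆ F → Δ G) ∧
    (∀ F G : Finset (Fin s), Δ F → Δ G → G.card < F.card →
      ∃ j ∈ F, j ∉ G ∧ Δ (insert j G))

/-- `F` is a basis (facet) of the simplicial complex `Δ`: a maximal face. -/
def IsBasisOf {s : ℕ} (Δ : Finset (Fin s) → Prop) (F : Finset (Fin s)) : Prop :=
  Δ F ∧ ∀ G : Finset (Fin s), Δ G → F ⊆ G → G = F

/-- The Stanley–Reisner ideal of `Δ`, generated by the squarefree monomials corresponding
to the non-faces of `Δ`. -/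
def stanleyReisnerIdeal (k : Type) [Field k] {s : ℕ} (Δ : Finset (Fin s) → Prop) :
    Ideal (MvPolynomial (Fin s) k) :=
  Ideal.span
    ((fun F : Finset (Fin s) => ∏ i ∈ F, (X i : MvPolynomial (Fin s) k)) '' {F | ¬ Δ F})

/-- The ideal `I_{W_c}`: the intersection of all ideals `(A_{i_1,j_1}, …, A_{i_c,j_c})`
where `i_1 < ⋯ < i_c` and each generator is chosen from a different group. -/
def multiPartiteIdeal {A : Type*} [CommRing A] {s : ℕ} (c : ℕ) {e : Fin s → ℕ}
    (g : (i : Fin s) → Fin (e i) → A) : Ideal A :=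
  ⨅ T ∈ {T : Finset (Fin s) | T.card = c}, ⨅ j : (i : Fin s) → Fin (e i),
    Ideal.span ((fun i => g i (j i)) '' ↑T)

end

open CategoryTheory.MonoidalCategory CategoryTheory.Limits

namespace TensorComplex

universe u

section Homology

variable {A : Type u} [CommRing A]

/-- The complex `X ⊗ Q`, where `Q` is a projective resolution of `N`. -/
noncomputable abbrev cx (X N : ModuleCat.{u} A) : ChainComplex (ModuleCat.{u} A) ℕ :=
  (((tensoringLeft (ModuleCat.{u} A)).obj X).mapHomologicalComplex _).obj
    (projectiveResolution N).complex

/-- The chain map `X ⊗ Q ⟶ Y ⊗ Q` induced by `X ⟶ Y`. -/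
noncomputable abbrev cxMap {X Y : ModuleCat.{u} A} (g : X ⟶ Y) (N : ModuleCat.{u} A) :
    cx X N ⟶ cx Y N :=
  (NatTrans.mapHomologicalComplex ((tensoringLeft (ModuleCat.{u} A)).map g) _).app
    (projectiveResolution N).complex

/-- The short complex of chain complexes obtained by tensoring a short complex with a projective
resolution of `N`. -/
noncomputable abbrev cxShort (C : ShortComplex (ModuleCat.{u} A)) (N : ModuleCat.{u} A) :
    ShortComplex (ChainComplex (ModuleCat.{u} A) ℕ) :=
  ShortComplex.mk (cxMap C.f N) (cxMap C.g N) (by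
    ext n : 1
    change C.f ▷ _ ≫ C.g ▷ _ = 0
    rw [← comp_whiskerRight, C.zero, MonoidalPreadditive.zero_whiskerRight])

lemma cxShort_shortExact {C : ShortComplex (ModuleCat.{u} A)} (hC : C.ShortExact)
    (N : ModuleCat.{u} A) : (cxShort C N).ShortExact := by
  apply HomologicalComplex.shortExact_of_degreewise_shortExact
  intro n
  have hP : Projective ((projectiveResolution N).complex.X n) := inferInstance
  have : Module.Projective A ((projectiveResolution N).complex.X n) :=
    (IsProjective.iff_projective _).2 hP
  exact hC.map_of_exact (tensorRight ((projectiveResolution N).complex.X n))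

/-- `H_0(X ⊗ Q) ≅ X ⊗ N`. -/
noncomputable def homologyZeroIso (X N : ModuleCat.{u} A) : (cx X N).homology 0 ≅ X ⊗ N :=
  (ChainComplex.isoHomologyι₀ _) ≪≫
    haveI : PreservesFiniteColimits ((tensoringLeft (ModuleCat.{u} A)).obj X) :=
      inferInstanceAs (PreservesFiniteColimits (tensorLeft X))
    asIso ((projectiveResolution N).fromLeftDerivedZero' ((tensoringLeft _).obj X))

lemma homologyZeroIso_naturality {X Y : ModuleCat.{u} A} (g : X ⟶ Y) (N : ModuleCat.{u} A) :
    HomologicalComplex.homologyMap (cxMap g N) 0 ≫ (homologyZeroIso Y N).hom =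
      (homologyZeroIso X N).hom ≫ g ▷ N := by
  have h : HomologicalComplex.opcyclesMap (cxMap g N) 0 ≫
      (projectiveResolution N).fromLeftDerivedZero' ((tensoringLeft _).obj Y) =
      (projectiveResolution N).fromLeftDerivedZero' ((tensoringLeft _).obj X) ≫ g ▷ N := by
    rw [← cancel_epi (HomologicalComplex.pOpcycles _ _),
      HomologicalComplex.p_opcyclesMap_assoc,
      ProjectiveResolution.pOpcycles_comp_fromLeftDerivedZero',
      ProjectiveResolution.pOpcycles_comp_fromLeftDerivedZero'_assoc]
    exact (whisker_exchange g _).symm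
  simp only [homologyZeroIso, Iso.trans_hom, asIso_hom, Category.assoc, ← h,
    ChainComplex.isoHomologyι₀]
  exact HomologicalComplex.homologyι_naturality_assoc _ _ _

/-- Tensoring a complex with a flat module preserves exactness in positive degrees. -/
lemma isZero_homology_succ_of_flat (X N : ModuleCat.{u} A) [Module.Flat A X] (i : ℕ) :
    IsZero ((cx X N).homology (i + 1)) := by
  rw [← HomologicalComplex.exactAt_iff_isZero_homology]
  have h : ((projectiveResolution N).complex.sc (i + 1)).Exact :=
    (projectiveResolution N).complex_exactAt_succ i
  exact h.map (tensorLeft X)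

variable {C : ShortComplex (ModuleCat.{u} A)}

/-- Vanishing of homology passes to extensions. -/
lemma isZero_homology_middle (hC : C.ShortExact) (N : ModuleCat.{u} A)
    (i : ℕ) (h₁ : IsZero ((cx C.X₁ N).homology i))
    (h₃ : IsZero ((cx C.X₃ N).homology i)) : IsZero ((cx C.X₂ N).homology i) :=
  ((cxShort_shortExact hC N).homology_exact₂ i).isZero_of_both_zeros
    (h₁.eq_of_src _ _) (h₃.eq_of_tgt _ _)

lemma isZero_homology_succ_right (hC : C.ShortExact) (N : ModuleCat.{u} A)
    (i : ℕ) (h₂ : IsZero ((cx C.X₂ N).homology (i + 1)))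
    (h₁ : IsZero ((cx C.X₁ N).homology i)) : IsZero ((cx C.X₃ N).homology (i + 1)) :=
  ((cxShort_shortExact hC N).homology_exact₃ (i + 1) i rfl).isZero_of_both_zeros
    (h₂.eq_of_src _ _) (h₁.eq_of_tgt _ _)

lemma isZero_homology_left (hC : C.ShortExact) (N : ModuleCat.{u} A)
    (i : ℕ) (h₃ : IsZero ((cx C.X₃ N).homology (i + 1)))
    (h₂ : IsZero ((cx C.X₂ N).homology i)) : IsZero ((cx C.X₁ N).homology i) :=
  ((cxShort_shortExact hC N).homology_exact₁ (i + 1) i rfl).isZero_of_both_zeros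
    (h₃.eq_of_src _ _) (h₂.eq_of_tgt _ _)

/-- Dimension shifting in the first variable of the tensor product. -/
noncomputable def homologyShiftIso (hC : C.ShortExact) (N : ModuleCat.{u} A)
    (i : ℕ) (h₂ : IsZero ((cx C.X₂ N).homology (i + 1)))
    (h₂' : IsZero ((cx C.X₂ N).homology i)) :
    (cx C.X₃ N).homology (i + 1) ≅ (cx C.X₁ N).homology i :=
  (cxShort_shortExact hC N).δIso (i + 1) i rfl h₂ h₂'

/-- The first homology as a kernel. -/
lemma exists_homologyOne_map (hC : C.ShortExact) (N : ModuleCat.{u} A)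
    (h₂ : IsZero ((cx C.X₂ N).homology 1)) :
    ∃ δ : (cx C.X₃ N).homology 1 →ₗ[A] TensorProduct A C.X₁ N, Function.Injective δ ∧
      LinearMap.range δ = LinearMap.ker (LinearMap.rTensor N C.f.hom) := by
  have hS := cxShort_shortExact hC N
  have hrel : (ComplexShape.down ℕ).Rel 1 0 := rfl
  have hm : Mono (hS.δ 1 0 hrel) := hS.mono_δ 1 0 hrel h₂
  have he := hS.homology_exact₁ 1 0 hrel
  have hz : hS.δ 1 0 hrel ≫ HomologicalComplex.homologyMap (cxMap C.f N) 0 = 0 :=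
    hS.δ_comp 1 0 hrel
  refine ⟨(hS.δ 1 0 hrel ≫ (homologyZeroIso C.X₁ N).hom).hom, ?_, ?_⟩
  · rw [← ModuleCat.mono_iff_injective]
    exact mono_comp _ _
  · have hex : (ShortComplex.mk (hS.δ 1 0 hrel ≫ (homologyZeroIso C.X₁ N).hom) (C.f ▷ N)
        (by rw [Category.assoc, ← homologyZeroIso_naturality,
          ← Category.assoc, hz, zero_comp])).Exact := by
      refine ShortComplex.exact_of_iso
        (ShortComplex.isoMk (S₁ := ShortComplex.mk _ _ hz) (Iso.refl _)
        (homologyZeroIso C.X₁ N) (homologyZeroIso C.X₂ N) ?_ ?_) he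
      · exact Category.id_comp _
      · exact (homologyZeroIso_naturality C.f N).symm
    exact hex.moduleCat_range_eq_ker

lemma isZero_homologyOne_iff (hC : C.ShortExact) (N : ModuleCat.{u} A)
    (h₂ : IsZero ((cx C.X₂ N).homology 1)) :
    IsZero ((cx C.X₃ N).homology 1) ↔ Function.Injective (LinearMap.rTensor N C.f.hom) := by
  obtain ⟨δ, hδ, hr⟩ := exists_homologyOne_map hC N h₂
  rw [← LinearMap.ker_eq_bot, ← hr, LinearMap.range_eq_bot, ModuleCat.isZero_iff_subsingleton]
  constructor
  · intro _
    ext x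
    rw [Subsingleton.elim x 0, map_zero, map_zero]
  · rintro rfl
    exact ⟨fun x y => hδ (by simp)⟩

end Homology

/-- All higher homology of `X ⊗ Q` vanishes, `Q` being a projective resolution of `N`. -/
def HigherVanishing {A : Type u} [CommRing A] (X N : ModuleCat.{u} A) : Prop :=
  ∀ i : ℕ, IsZero ((cx X N).homology (i + 1))

section BaseChange

variable (S R : Type u) [CommRing S] [CommRing R] [Algebra S R]

/-- An `S`-module and an `R`-module that are isomorphic along the structure map `S → R`. -/
def SemilinearIso (X Y : Type u) [AddCommGroup X] [Module S X] [AddCommGroup Y]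
    [Module R Y] : Prop :=
  ∃ e : X ≃+ Y, ∀ (s : S) (x : X), e (s • x) = algebraMap S R s • e x

variable {S R}

lemma SemilinearIso.congr {X X' Y Y' : Type u} [AddCommGroup X] [Module S X] [AddCommGroup X']
    [Module S X'] [AddCommGroup Y] [Module R Y] [AddCommGroup Y'] [Module R Y']
    (h : SemilinearIso S R X Y) (a : X' ≃ₗ[S] X) (b : Y' ≃ₗ[R] Y) :
    SemilinearIso S R X' Y' := by
  obtain ⟨e, he⟩ := h
  exact ⟨(a.toAddEquiv.trans e).trans b.symm.toAddEquiv, fun s x => by simp [he]⟩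

lemma SemilinearIso.of_injective {X X' Y Y' : Type u} [AddCommGroup X] [Module S X]
    [AddCommGroup X'] [Module S X'] [AddCommGroup Y] [Module R Y] [AddCommGroup Y'] [Module R Y']
    (a : X →ₗ[S] X') (ha : Function.Injective a) (b : Y →ₗ[R] Y') (hb : Function.Injective b)
    (e : X' ≃+ Y') (he : ∀ (s : S) (x : X'), e (s • x) = algebraMap S R s • e x)
    (hab : ∀ x, x ∈ LinearMap.range a ↔ e x ∈ LinearMap.range b) : SemilinearIso S R X Y := by
  have h₁ : ∀ x, ∃ y, b y = e (a x) := fun x => (hab (a x)).1 ⟨x, rfl⟩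
  choose g hg using h₁
  refine ⟨AddEquiv.ofBijective (AddMonoidHom.mk' g fun x y => hb ?_)
      ⟨fun x y hxy => ?_, fun y => ?_⟩,
    fun s x => hb ?_⟩
  · simp [hg]
  · apply ha
    apply e.injective
    rw [← hg, ← hg]
    exact congrArg b hxy
  · obtain ⟨x, hx⟩ := (hab (e.symm (b y))).2 (by simp)
    exact ⟨x, hb (by simp [hg, hx])⟩
  · change b (g (s • x)) = b (algebraMap S R s • g x)
    rw [map_smul, hg, hg, map_smul, he]

variable (N : Type u) [AddCommGroup N] [Module R N] [Module S N] [IsScalarTower S R N]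

variable (S R) in
/-- The canonical isomorphism `X ⊗_S N ≃ (R ⊗_S X) ⊗_R N`. -/
noncomputable def tensorCancel (X : Type u) [AddCommGroup X] [Module S X] :
    TensorProduct S X N ≃+ TensorProduct R (TensorProduct S R X) N :=
  ((TensorProduct.comm S X N).toAddEquiv.trans
    (TensorProduct.AlgebraTensorModule.cancelBaseChange S R R N X).symm.toAddEquiv).trans
    (TensorProduct.comm R N (TensorProduct S R X)).toAddEquiv

@[simp]
lemma tensorCancel_tmul (X : Type u) [AddCommGroup X] [Module S X] (x : X) (y : N) :
    tensorCancel S R N X (x ⊗ₜ y) = (1 ⊗ₜ x) ⊗ₜ y := by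
  simp [tensorCancel]

lemma tensorCancel_smul (X : Type u) [AddCommGroup X] [Module S X] (s : S)
    (t : TensorProduct S X N) :
    tensorCancel S R N X (s • t) = algebraMap S R s • tensorCancel S R N X t := by
  induction t with
  | zero => simp
  | add a b ha hb => simp [smul_add, ha, hb]
  | tmul x y =>
    rw [← TensorProduct.tmul_smul, tensorCancel_tmul, tensorCancel_tmul,
      ← TensorProduct.tmul_smul, algebraMap_smul]

lemma tensorCancel_naturality {X Y : Type u} [AddCommGroup X] [Module S X] [AddCommGroup Y]
    [Module S Y] (g : X →ₗ[S] Y) (t : TensorProduct S X N) :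
    tensorCancel S R N Y (g.rTensor N t) =
      (g.baseChange R).rTensor N (tensorCancel S R N X t) := by
  induction t with
  | zero => simp
  | add a b ha hb => simp [ha, hb]
  | tmul x y => simp

variable (S) in
/-- The short complex `0 → K → P → M → 0` presenting `M` by the free module on its elements. -/
noncomputable abbrev presentation (M : Type u) [AddCommGroup M] [Module S M] :
    ShortComplex (ModuleCat.{u} S) :=
  ShortComplex.mk
    (X₁ := ModuleCat.of S (LinearMap.ker (Finsupp.linearCombination S (id : M → M))))
    (X₂ := ModuleCat.of S (M →₀ S)) (X₃ := ModuleCat.of S M)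
    (ModuleCat.ofHom (LinearMap.ker (Finsupp.linearCombination S (id : M → M))).subtype)
    (ModuleCat.ofHom (Finsupp.linearCombination S (id : M → M)))
    (ModuleCat.hom_ext (LinearMap.ext fun x => x.2))

lemma presentation_shortExact (M : Type u) [AddCommGroup M] [Module S M] :
    (presentation S M).ShortExact where
  exact := by
    rw [ShortComplex.ShortExact.moduleCat_exact_iff_function_exact]
    exact LinearMap.exact_subtype_ker_map _
  mono_f := (ModuleCat.mono_iff_injective _).2 Subtype.val_injective
  epi_g := (ModuleCat.epi_iff_surjective _).2 (Finsupp.linearCombination_id_surjective S M)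

variable (R) in
/-- Extension of scalars of a short complex. -/
noncomputable abbrev baseChangeShort (C : ShortComplex (ModuleCat.{u} S)) :
    ShortComplex (ModuleCat.{u} R) :=
  ShortComplex.mk (X₁ := ModuleCat.of R (TensorProduct S R C.X₁))
    (X₂ := ModuleCat.of R (TensorProduct S R C.X₂)) (X₃ := ModuleCat.of R (TensorProduct S R C.X₃))
    (ModuleCat.ofHom (C.f.hom.baseChange R)) (ModuleCat.ofHom (C.g.hom.baseChange R))
    (by
      rw [← ModuleCat.ofHom_comp, ← LinearMap.baseChange_comp, ← ModuleCat.hom_comp, C.zero,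
        ModuleCat.hom_zero, LinearMap.baseChange_zero]
      rfl)

lemma baseChangeShort_shortExact {C : ShortComplex (ModuleCat.{u} S)} (hC : C.ShortExact)
    (hinj : Function.Injective (LinearMap.rTensor R C.f.hom)) :
    (baseChangeShort R C).ShortExact where
  exact := by
    rw [ShortComplex.ShortExact.moduleCat_exact_iff_function_exact]
    exact lTensor_exact R
      ((ShortComplex.ShortExact.moduleCat_exact_iff_function_exact _).1 hC.exact)
      hC.moduleCat_surjective_g
  mono_f := by
    rw [ModuleCat.mono_iff_injective]
    exact (LinearMap.lTensor_inj_iff_rTensor_inj R C.f.hom).2 hinj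
  epi_g := by
    rw [ModuleCat.epi_iff_surjective]
    exact LinearMap.lTensor_surjective R hC.moduleCat_surjective_g

/-- Base change for the homology of `M ⊗ Q`: if `M` has no higher Tor against `R`, then
`Tor^S(M, N)` agrees with `Tor^R(R ⊗_S M, N)` for every `R`-module `N`. -/
theorem semilinearIso_homology (i : ℕ) : ∀ (M : Type u) [AddCommGroup M] [Module S M],
    HigherVanishing (ModuleCat.of S M) (ModuleCat.of S R) →
    SemilinearIso S R ((cx (ModuleCat.of S M) (ModuleCat.of S N)).homology i)
      ((cx (ModuleCat.of R (TensorProduct S R M)) (ModuleCat.of R N)).homology i) := by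
  induction i with
  | zero =>
    intro M _ _ _
    refine SemilinearIso.congr ⟨tensorCancel S R N M, tensorCancel_smul (R := R) N M⟩
      (homologyZeroIso (ModuleCat.of S M) (ModuleCat.of S N)).toLinearEquiv
      (homologyZeroIso (ModuleCat.of R (TensorProduct S R M)) (ModuleCat.of R N)).toLinearEquiv
  | succ i ih =>
    intro M _ _ hM
    have hC := presentation_shortExact (S := S) M
    have : Module.Flat S (presentation S M).X₂ := inferInstanceAs (Module.Flat S (M →₀ S))
    have : Module.Flat R (baseChangeShort R (presentation S M)).X₂ :=
      inferInstanceAs (Module.Flat R (TensorProduct S R (M →₀ S)))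
    have hinj : Function.Injective (LinearMap.rTensor R (presentation S M).f.hom) :=
      (isZero_homologyOne_iff hC (ModuleCat.of S R) (isZero_homology_succ_of_flat _ _ 0)).1 (hM 0)
    have hC' := baseChangeShort_shortExact hC hinj
    cases i with
    | zero =>
      obtain ⟨a, ha, har⟩ := exists_homologyOne_map hC (ModuleCat.of S N)
        (isZero_homology_succ_of_flat _ _ 0)
      obtain ⟨b, hb, hbr⟩ := exists_homologyOne_map hC' (ModuleCat.of R N)
        (isZero_homology_succ_of_flat _ _ 0)
      refine SemilinearIso.of_injective a ha b hb (tensorCancel S R N _)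
        (tensorCancel_smul (R := R) N _) fun x => ?_
      rw [har, hbr, LinearMap.mem_ker, LinearMap.mem_ker]
      refine Iff.trans ?_ (Eq.congr_left
        (tensorCancel_naturality (R := R) N (presentation S M).f.hom x))
      exact (AddEquiv.map_eq_zero_iff (tensorCancel S R N _)).symm
    | succ i =>
      have hK : HigherVanishing (presentation S M).X₁ (ModuleCat.of S R) := fun j =>
        isZero_homology_left hC _ _ (hM (j + 1)) (isZero_homology_succ_of_flat _ _ j)
      exact (ih _ hK).congr
        (homologyShiftIso hC (ModuleCat.of S N) (i + 1) (isZero_homology_succ_of_flat _ _ _)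
          (isZero_homology_succ_of_flat _ _ _)).toLinearEquiv
        (homologyShiftIso hC' (ModuleCat.of R N) (i + 1) (isZero_homology_succ_of_flat _ _ _)
          (isZero_homology_succ_of_flat _ _ _)).toLinearEquiv

end BaseChange

section Quotient

variable {A : Type u} [CommRing A]

/-- The short complex `0 → A/J → A/I → A/K → 0`, the first map being multiplication by `y`, where
`J = (I : y)` and `K = I + (y)`. -/
noncomputable abbrev colonShort (I J K : Ideal A) (y : A) (hJ : ∀ g, g ∈ J ↔ y * g ∈ I)
    (hK : K = I ⊔ Ideal.span {y}) : ShortComplex (ModuleCat.{u} A) :=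
  ShortComplex.mk (X₁ := ModuleCat.of A (A ⧸ J)) (X₂ := ModuleCat.of A (A ⧸ I))
    (X₃ := ModuleCat.of A (A ⧸ K))
    (ModuleCat.ofHom (Submodule.mapQ J I (LinearMap.mulLeft A y) fun g hg => (hJ g).1 hg))
    (ModuleCat.ofHom (Submodule.factor (hK ▸ le_sup_left : I ≤ K)))
    (ModuleCat.hom_ext <| Submodule.linearMap_qext _ <| LinearMap.ext fun g =>
      (Submodule.Quotient.mk_eq_zero K).2 <| hK ▸
        Ideal.mul_mem_right g _ (Ideal.mem_sup_right (Ideal.mem_span_singleton_self y)))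

lemma colonShort_shortExact (I J K : Ideal A) (y : A) (hJ : ∀ g, g ∈ J ↔ y * g ∈ I)
    (hK : K = I ⊔ Ideal.span {y}) : (colonShort I J K y hJ hK).ShortExact where
  exact := by
    rw [ShortComplex.moduleCat_exact_iff]
    intro x hx
    obtain ⟨x, rfl⟩ := Submodule.Quotient.mk_surjective I x
    have hx' : x ∈ I ⊔ Ideal.span {y} := hK ▸ (Submodule.Quotient.mk_eq_zero K).1 hx
    obtain ⟨a, ha, b, hb, rfl⟩ := Submodule.mem_sup.1 hx'
    obtain ⟨c, rfl⟩ := Ideal.mem_span_singleton'.1 hb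
    refine ⟨Submodule.Quotient.mk c, ?_⟩
    change (Submodule.Quotient.mk (y * c) : A ⧸ I) = Submodule.Quotient.mk (a + c * y)
    rw [Submodule.Quotient.eq]
    have : y * c - (a + c * y) = -a := by ring
    rw [this]
    exact I.neg_mem ha
  mono_f := by
    rw [ModuleCat.mono_iff_injective]
    refine (injective_iff_map_eq_zero (Submodule.mapQ J I (LinearMap.mulLeft A y)
      fun g hg => (hJ g).1 hg)).2 fun x hx => ?_
    obtain ⟨x, rfl⟩ := Submodule.Quotient.mk_surjective J x
    exact (Submodule.Quotient.mk_eq_zero J).2 ((hJ x).2 ((Submodule.Quotient.mk_eq_zero I).1 hx))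
  epi_g := by
    rw [ModuleCat.epi_iff_surjective]
    exact Submodule.factor_surjective (hK ▸ le_sup_left : I ≤ K)

lemma HigherVanishing.of_colon {I J K : Ideal A} (y : A) (hJ : ∀ g, g ∈ J ↔ y * g ∈ I)
    (hK : K = I ⊔ Ideal.span {y}) {N : ModuleCat.{u} A}
    (h₁ : HigherVanishing (ModuleCat.of A (A ⧸ J)) N)
    (h₃ : HigherVanishing (ModuleCat.of A (A ⧸ K)) N) :
    HigherVanishing (ModuleCat.of A (A ⧸ I)) N := fun i =>
  isZero_homology_middle (colonShort_shortExact I J K y hJ hK) N _ (h₁ i) (h₃ i)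

lemma HigherVanishing.sup_span_singleton {I K : Ideal A} (y : A) (hI : ∀ g, y * g ∈ I → g ∈ I)
    (hK : K = I ⊔ Ideal.span {y}) (N : Type u) [AddCommGroup N] [Module A N]
    (hN : IsSMulRegular (N ⧸ (I • ⊤ : Submodule A N)) y)
    (h : HigherVanishing (ModuleCat.of A (A ⧸ I)) (ModuleCat.of A N)) :
    HigherVanishing (ModuleCat.of A (A ⧸ K)) (ModuleCat.of A N) := by
  have hC := colonShort_shortExact I I K y (fun g => ⟨I.mul_mem_left y, hI g⟩) hK
  intro i
  cases i with
  | succ i => exact isZero_homology_succ_right hC _ _ (h (i + 1)) (h i)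
  | zero =>
    refine (isZero_homologyOne_iff hC _ (h 0)).2 ?_
    have hreg : IsSMulRegular (TensorProduct A (A ⧸ I) N) y :=
      ((TensorProduct.quotTensorEquivQuotSMul N I).isSMulRegular_congr y).2 hN
    have heq : Submodule.mapQ I I (LinearMap.mulLeft A y) (fun g hg => I.mul_mem_left y hg) =
        y • LinearMap.id := Submodule.linearMap_qext _ (LinearMap.ext fun g => rfl)
    have : LinearMap.rTensor N (Submodule.mapQ I I (LinearMap.mulLeft A y)
        (fun g hg => I.mul_mem_left y hg)) = y • LinearMap.id := by
      rw [heq, LinearMap.rTensor_smul, LinearMap.rTensor_id]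
    change Function.Injective (LinearMap.rTensor N (Submodule.mapQ I I (LinearMap.mulLeft A y)
        (fun g hg => I.mul_mem_left y hg)))
    rw [this]
    exact hreg

end Quotient

section Monomial

variable {k : Type u} [Field k] {σ : Type u}

/-- Koszul-type vanishing for ideals generated by variables. -/
lemma higherVanishing_span_X (N : Type u) [AddCommGroup N] [Module (MvPolynomial σ k) N]
    (l : List σ) :
    l.Nodup → RingTheory.Sequence.IsWeaklyRegular N (l.map (X : σ → MvPolynomial σ k)) →
    HigherVanishing (ModuleCat.of (MvPolynomial σ k)
      (MvPolynomial σ k ⧸ Ideal.span ((X : σ → MvPolynomial σ k) '' {i | i ∈ l})))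
      (ModuleCat.of (MvPolynomial σ k) N) := by
  have hspan (l : List σ) : Ideal.ofList (l.map (X : σ → MvPolynomial σ k)) =
      Ideal.span (X '' {i | i ∈ l}) := by
    rw [Ideal.ofList]
    congr 1
    ext
    simp
  induction l using List.reverseRecOn with
  | nil =>
    intro _ _ i
    have : Module.Flat (MvPolynomial σ k) (MvPolynomial σ k ⧸
        Ideal.span ((X : σ → MvPolynomial σ k) '' {i | i ∈ ([] : List σ)})) :=
      Module.Flat.of_linearEquiv (Submodule.quotEquivOfEqBot _ (by simp))
    exact isZero_homology_succ_of_flat (ModuleCat.of _ _) _ i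
  | append_singleton l v ih =>
    intro hl hreg
    rw [List.map_append, RingTheory.Sequence.isWeaklyRegular_append_iff, hspan, List.map_singleton,
      RingTheory.Sequence.isWeaklyRegular_singleton_iff] at hreg
    rw [List.nodup_append] at hl
    refine HigherVanishing.sup_span_singleton (X v) (fun g hg => ?_) ?_ N hreg.2 (ih hl.1 hreg.1)
    · rw [mem_ideal_span_X_image] at hg ⊢
      intro m hm
      obtain ⟨i, hi, hmi⟩ := hg (Finsupp.single v 1 + m) (by
        rw [support_X_mul]
        exact Finset.mem_map_of_mem _ hm)
      refine ⟨i, hi, ?_⟩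
      have hiv : v ≠ i := fun h => hl.2.2 i hi v (by simp) h.symm
      simpa [hiv] using hmi
    · rw [← hspan, List.map_append, Ideal.ofList_append, hspan, List.map_singleton,
        Ideal.ofList_singleton]

end Monomial

end TensorComplex

section StanleyReisner

variable {k : Type} [Field k] {s : ℕ} {Δ : Finset (Fin s) → Prop}

lemma mem_stanleyReisnerIdeal (hΔ : ∀ F G : Finset (Fin s), Δ F → G ⊆ F → Δ G)
    {p : MvPolynomial (Fin s) k} :
    p ∈ stanleyReisnerIdeal k Δ ↔ ∀ m ∈ p.support, ¬ Δ m.support := by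
  have h : stanleyReisnerIdeal k Δ = Ideal.span ((fun m => monomial m (1 : k)) ''
      ((fun F : Finset (Fin s) => ∑ i ∈ F, Finsupp.single i 1) '' {F | ¬ Δ F})) := by
    rw [stanleyReisnerIdeal, Set.image_image]
    congr 2
    ext1 F
    exact (monomial_sum_one F fun i => Finsupp.single i 1).symm
  have hsum (F : Finset (Fin s)) (i : Fin s) :
      (∑ j ∈ F, Finsupp.single j 1 : Fin s →₀ ℕ) i = if i ∈ F then 1 else 0 := by
    simp [Finsupp.single_apply]
  rw [h, mem_ideal_span_monomial_image]
  refine forall₂_congr fun m _ => ⟨?_, fun hm => ⟨_, ⟨m.support, hm, rfl⟩, fun i => ?_⟩⟩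
  · rintro ⟨_, ⟨F, hF, rfl⟩, hle⟩ hm
    refine hF (hΔ _ _ hm fun i hi => ?_)
    have := hle i
    rw [hsum, if_pos hi] at this
    exact Finsupp.mem_support_iff.2 (by omega)
  · rw [hsum]
    split_ifs with hi
    · exact Nat.one_le_iff_ne_zero.2 (Finsupp.mem_support_iff.1 hi)
    · exact Nat.zero_le _

lemma mem_stanleyReisnerIdeal_star (hΔ : ∀ F G : Finset (Fin s), Δ F → G ⊆ F → Δ G) (v : Fin s)
    (g : MvPolynomial (Fin s) k) :
    g ∈ stanleyReisnerIdeal k (fun F => Δ (insert v F)) ↔ X v * g ∈ stanleyReisnerIdeal k Δ := by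
  rw [mem_stanleyReisnerIdeal hΔ,
    mem_stanleyReisnerIdeal fun F G hF hGF => hΔ _ _ hF (Finset.insert_subset_insert v hGF),
    support_X_mul]
  have hsupp (m : Fin s →₀ ℕ) : (Finsupp.single v 1 + m).support = insert v m.support := by
    ext i
    by_cases hi : v = i <;> simp [hi, eq_comm]
  simp only [Finset.mem_map, addLeftEmbedding_apply, forall_exists_index, and_imp,
    forall_apply_eq_imp_iff₂, hsupp]

lemma stanleyReisnerIdeal_deletion (v : Fin s) :
    stanleyReisnerIdeal k (fun F => Δ F ∧ v ∉ F) =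
      stanleyReisnerIdeal k Δ ⊔ Ideal.span {X v} := by
  apply le_antisymm
  · refine Ideal.span_le.2 ?_
    rintro _ ⟨F, hF, rfl⟩
    by_cases hv : v ∈ F
    · exact Ideal.mem_sup_right (Ideal.mem_span_singleton.2 (Finset.dvd_prod_of_mem _ hv))
    · exact Ideal.mem_sup_left (Ideal.subset_span ⟨F, fun h => hF ⟨h, hv⟩, rfl⟩)
  · refine sup_le (Ideal.span_mono (Set.image_mono fun F hF h => hF h.1)) ?_
    rw [Ideal.span_singleton_le_iff_mem]
    exact Ideal.subset_span ⟨{v}, fun h => h.2 (Finset.mem_singleton_self v), by simp⟩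

end StanleyReisner

section Matroid

variable {s : ℕ} {Δ : Finset (Fin s) → Prop}

lemma IsMatroid.star (h : IsMatroid Δ) {v : Fin s} (hv : Δ {v}) :
    IsMatroid (fun F => Δ (insert v F)) := by
  refine ⟨by simpa using hv,
    fun F G hF hGF => h.2.1 _ _ hF (Finset.insert_subset_insert v hGF), fun F G hF hG hlt => ?_⟩
  by_cases hvF : v ∈ F ∧ v ∉ G
  · exact ⟨v, hvF.1, hvF.2, by simpa using hG⟩
  · have hlt' : (insert v G).card < (insert v F).card := by
      by_cases hvG : v ∈ G
      · rw [Finset.insert_eq_of_mem hvG]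
        exact hlt.trans_le (Finset.card_le_card (Finset.subset_insert v F))
      · have hvF' : v ∉ F := fun h => hvF ⟨h, hvG⟩
        rw [Finset.card_insert_of_notMem hvG, Finset.card_insert_of_notMem hvF']
        omega
    obtain ⟨j, hjF, hjG, hj⟩ := h.2.2 _ _ hF hG hlt'
    rw [Finset.mem_insert, not_or] at hjG
    refine ⟨j, (Finset.mem_insert.1 hjF).resolve_left hjG.1, hjG.2, ?_⟩
    change Δ (insert v (insert j G))
    rwa [Finset.insert_comm]

lemma IsMatroid.deletion (h : IsMatroid Δ) (v : Fin s) : IsMatroid (fun F => Δ F ∧ v ∉ F) := by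
  refine ⟨⟨h.1, by simp⟩, fun F G hF hGF => ⟨h.2.1 _ _ hF.1 hGF, fun hv => hF.2 (hGF hv)⟩,
    fun F G hF hG hlt => ?_⟩
  obtain ⟨j, hjF, hjG, hj⟩ := h.2.2 _ _ hF.1 hG.1 hlt
  refine ⟨j, hjF, hjG, hj, ?_⟩
  rw [Finset.mem_insert, not_or]
  exact ⟨fun hvj => hF.2 (hvj ▸ hjF), hG.2⟩

lemma IsMatroid.exists_superset (h : IsMatroid Δ) {B : Finset (Fin s)} (hB : Δ B)
    {F : Finset (Fin s)} (hF : Δ F) (hFB : F.card ≤ B.card) :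
    ∃ G, Δ G ∧ F ⊆ G ∧ G.card = B.card := by
  induction hn : B.card - F.card generalizing F with
  | zero => exact ⟨F, hF, subset_rfl, by omega⟩
  | succ n ih =>
    obtain ⟨j, _, hjF, hj⟩ := h.2.2 _ _ hB hF (by omega)
    have hc := Finset.card_insert_of_notMem hjF
    obtain ⟨G, hG, hFG, hGc⟩ := ih hj (by omega) (by omega)
    exact ⟨G, hG, (Finset.subset_insert j F).trans hFG, hGc⟩

lemma exists_isBasisOf_superset {F : Finset (Fin s)} (hF : Δ F) : ∃ B, IsBasisOf Δ B ∧ F ⊆ B := by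
  obtain ⟨B, hFB, hB⟩ := (Set.toFinite {G | Δ G}).exists_le_maximal hF
  exact ⟨B, ⟨hB.prop, fun G hG hBG => (hB.eq_of_le hG hBG).symm⟩, hFB⟩

/-- The quotient by the Stanley–Reisner ideal of a matroid of rank `r` is an iterated extension of
quotients by ideals generated by `s - r` variables. -/
theorem IsMatroid.stanleyReisner_induction {k : Type} [Field k] {r : ℕ}
    (P : Ideal (MvPolynomial (Fin s) k) → Prop)
    (hX : ∀ T : Finset (Fin s), T.card = s - r → P (Ideal.span (X '' (T : Set (Fin s)))))
    (hcolon : ∀ (I J K : Ideal (MvPolynomial (Fin s) k)) (v : Fin s),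
      (∀ g, g ∈ J ↔ X v * g ∈ I) → K = I ⊔ Ideal.span {X v} → P J → P K → P I)
    (h : IsMatroid Δ) (hle : ∀ F, Δ F → F.card ≤ r) (hr : ∃ F, Δ F ∧ F.card = r) :
    P (stanleyReisnerIdeal k Δ) := by
  classical
  induction hn : (Finset.univ.filter fun F => Δ F ∧ F.card = r).card using Nat.strong_induction_on
    generalizing Δ with
  | _ n ih =>
    subst hn
    obtain ⟨B, hB, hBr⟩ := hr
    by_cases huniq : ∀ B', Δ B' → B'.card = r → B' = B
    · have hΔ (F : Finset (Fin s)) : Δ F ↔ F ⊆ B := by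
        refine ⟨fun hF => ?_, fun hF => h.2.1 _ _ hB hF⟩
        obtain ⟨G, hG, hFG, hGc⟩ := h.exists_superset hB hF (hBr ▸ hle F hF)
        exact huniq G hG (hGc.trans hBr) ▸ hFG
      have hI : stanleyReisnerIdeal k Δ =
          Ideal.span (X '' ((Bᶜ : Finset (Fin s)) : Set (Fin s))) := by
        ext p
        rw [mem_stanleyReisnerIdeal h.2.1, mem_ideal_span_X_image]
        refine forall₂_congr fun m _ => ?_
        rw [hΔ, Finset.not_subset]
        simp only [Finsupp.mem_support_iff, Finset.coe_compl, Set.mem_compl_iff, Finset.mem_coe]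
        exact exists_congr fun i => and_comm
      rw [hI]
      exact hX _ (by rw [Finset.card_compl, Fintype.card_fin, hBr])
    · push Not at huniq
      obtain ⟨B', hB', hB'r, hne⟩ := huniq
      obtain ⟨v, hvB, hvB'⟩ := Finset.not_subset.1 fun hsub : B ⊆ B' =>
        hne (Finset.eq_of_subset_of_card_le hsub (by omega)).symm
      refine hcolon _ _ _ v (mem_stanleyReisnerIdeal_star h.2.1 v) (stanleyReisnerIdeal_deletion v)
        (ih _ ?_ (h.star (h.2.1 _ _ hB (by simpa using hvB)))
          (fun F hF => (Finset.card_le_card (Finset.subset_insert v F)).trans (hle _ hF))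
          ⟨B, by rwa [Finset.insert_eq_of_mem hvB], hBr⟩ rfl)
        (ih _ ?_ (h.deletion v) (fun F hF => hle F hF.1) ⟨B', ⟨hB', hvB'⟩, hB'r⟩ rfl)
      · refine Finset.card_lt_card (Finset.ssubset_iff_of_subset ?_ |>.2 ⟨B', ?_⟩)
        · intro F hF
          simp only [Finset.mem_filter, Finset.mem_univ, true_and] at hF ⊢
          exact ⟨h.2.1 _ _ hF.1 (Finset.subset_insert v F), hF.2⟩
        · simp only [Finset.mem_filter, Finset.mem_univ, true_and]
          refine ⟨⟨hB', hB'r⟩, fun hc => ?_⟩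
          have := hle _ hc.1
          rw [Finset.card_insert_of_notMem hvB'] at this
          omega
      · refine Finset.card_lt_card (Finset.ssubset_iff_of_subset ?_ |>.2 ⟨B, ?_⟩)
        · intro F hF
          simp only [Finset.mem_filter, Finset.mem_univ, true_and] at hF ⊢
          exact ⟨hF.1.1, hF.2⟩
        · simp only [Finset.mem_filter, Finset.mem_univ, true_and]
          exact ⟨⟨hB, hBr⟩, fun hc => hc.1.2 hvB⟩

end Matroid

namespace TensorComplex

section TorRank

variable {k : Type} [Field k]

lemma SemilinearIso.rank_eq {S R : Type} [CommRing S] [CommRing R] [Algebra S R] [Algebra k S]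
    [Algebra k R] [IsScalarTower k S R] {X Y : Type} [AddCommGroup X] [Module S X]
    [AddCommGroup Y] [Module R Y] (h : SemilinearIso S R X Y) :
    Module.rank k (RestrictScalars k S X) = Module.rank k (RestrictScalars k R Y) := by
  obtain ⟨e, he⟩ := h
  refine LinearEquiv.rank_eq
    { ((RestrictScalars.addEquiv k S X).trans e).trans (RestrictScalars.addEquiv k R Y).symm with
      map_smul' := fun a x => ?_ }
  change (RestrictScalars.addEquiv k R Y).symm (e (RestrictScalars.addEquiv k S X (a • x))) =
    a • (RestrictScalars.addEquiv k R Y).symm (e (RestrictScalars.addEquiv k S X x))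
  rw [RestrictScalars.addEquiv_map_smul, he, ← IsScalarTower.algebraMap_apply,
    RestrictScalars.addEquiv_symm_map_algebraMap_smul]

/-- `Tor_i(X, N)` as the homology of `X ⊗ Q`. -/
noncomputable def torIso {A : Type} [CommRing A] (X N : ModuleCat.{0} A) (i : ℕ) :
    ((Tor (ModuleCat A) i).obj X).obj N ≅ (cx X N).homology i :=
  (projectiveResolution N).isoLeftDerivedObj ((tensoringLeft _).obj X) i

lemma torRank_congr {A : Type} [CommRing A] [Algebra k A] {M M' N N' : Type}
    [AddCommGroup M] [Module A M] [AddCommGroup M'] [Module A M']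
    [AddCommGroup N] [Module A N] [AddCommGroup N'] [Module A N']
    (e : M ≃ₗ[A] M') (e' : N ≃ₗ[A] N') (i : ℕ) :
    torRank k A M N i = torRank k A M' N' i := by
  have a := ((((Tor (ModuleCat A) i).mapIso e.toModuleIso).app (ModuleCat.of A N)) ≪≫
    ((Tor (ModuleCat A) i).obj (ModuleCat.of A M')).mapIso e'.toModuleIso).toLinearEquiv
  exact SemilinearIso.rank_eq (S := A) (R := A) ⟨a.toAddEquiv, fun s x => a.map_smul s x⟩

/-- Base change for `Tor` along `S → R` when `Tor_i^S(M, R) = 0` for all `i > 0`. -/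
theorem torRank_baseChange {S R : Type} [CommRing S] [CommRing R] [Algebra S R] [Algebra k S]
    [Algebra k R] [IsScalarTower k S R] (M N : Type) [AddCommGroup M] [Module S M]
    [AddCommGroup N] [Module R N] [Module S N] [IsScalarTower S R N]
    (h : HigherVanishing (ModuleCat.of S M) (ModuleCat.of S R)) (i : ℕ) :
    torRank k R (TensorProduct S R M) N i = torRank k S M N i :=
  ((semilinearIso_homology N i M h).congr (torIso _ _ i).toLinearEquiv
    (torIso _ _ i).toLinearEquiv).rank_eq.symm

end TorRank

end TensorComplex

section IrrelevantIdeal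

variable {k : Type} [Field k] {σ τ : Type}

lemma mem_irrelevantIdeal {p : MvPolynomial σ k} :
    p ∈ irrelevantIdeal k σ ↔ constantCoeff p = 0 := by
  rw [irrelevantIdeal, ← Set.image_univ, mem_ideal_span_X_image]
  simp only [Set.mem_univ, true_and, mem_support_iff, constantCoeff_eq]
  constructor
  · intro h
    by_contra h0
    simpa using h 0 h0
  · intro h m hm
    by_contra! h0
    exact hm ((Finsupp.ext h0 : m = 0) ▸ h)

/-- A form which is a nonunit has no constant term. -/
lemma constantCoeff_eq_zero_of_isRegular {p : MvPolynomial σ k} {d : ℕ} (hp : p.IsHomogeneous d)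
    (h : RingTheory.Sequence.IsRegular (MvPolynomial σ k) [p]) : constantCoeff p = 0 := by
  by_contra h0
  have hd : d = 0 := by
    have := hp h0
    simpa using this.symm
  subst hd
  have hC : p = C (constantCoeff p) := by
    rw [constantCoeff_eq]
    exact totalDegree_eq_zero_iff_eq_C.1 (Nat.le_zero.1 hp.totalDegree_le)
  refine h.top_ne_smul ?_
  have hu : IsUnit p := hC ▸ (isUnit_iff_ne_zero.2 h0).map C
  rw [Ideal.ofList_singleton, Ideal.span_singleton_eq_top.2 hu]
  simp

lemma constantCoeff_aeval {f : σ → MvPolynomial τ k} (hf : ∀ i, constantCoeff (f i) = 0)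
    (p : MvPolynomial σ k) : constantCoeff (aeval f p) = constantCoeff p := by
  induction p using MvPolynomial.induction_on with
  | C a => simp
  | add p q hp hq => rw [map_add, map_add, map_add, hp, hq]
  | mul_X p i hp => simp [hf]

/-- If `y_i` maps to a polynomial without constant term for every `i`, then `k` is the residue
field on both sides. -/
noncomputable def quotientIrrelevantIdealEquiv [Algebra (MvPolynomial σ k) (MvPolynomial τ k)]
    (h : ∀ p : MvPolynomial σ k,
      constantCoeff (algebraMap (MvPolynomial σ k) (MvPolynomial τ k) p) = constantCoeff p) :
    (MvPolynomial σ k ⧸ irrelevantIdeal k σ) ≃ₗ[MvPolynomial σ k]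
      (MvPolynomial τ k ⧸ irrelevantIdeal k τ) :=
  (Submodule.quotEquivOfEq _ _ (by
      ext p
      rw [LinearMap.mem_ker, Algebra.linearMap_apply,
        IsScalarTower.algebraMap_apply _ (MvPolynomial τ k), Ideal.Quotient.algebraMap_eq,
        Ideal.Quotient.eq_zero_iff_mem, mem_irrelevantIdeal, mem_irrelevantIdeal, h])).trans
    ((Algebra.linearMap (MvPolynomial σ k)
      (MvPolynomial τ k ⧸ irrelevantIdeal k τ)).quotKerEquivOfSurjective (by
        intro q
        obtain ⟨q, rfl⟩ := Ideal.Quotient.mk_surjective q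
        refine ⟨C (constantCoeff q), ?_⟩
        rw [Algebra.linearMap_apply, IsScalarTower.algebraMap_apply _ (MvPolynomial τ k),
          Ideal.Quotient.algebraMap_eq, Ideal.Quotient.eq, mem_irrelevantIdeal, map_sub, h]
        simp))

end IrrelevantIdeal

open TensorComplex in
/-- `Tor_i(S/I_Δ, N)` vanishes for `i > 0` if all sequences of `s - r` variables, `r` being the
rank of the matroid `Δ`, are weakly `N`-regular. -/
theorem IsMatroid.higherVanishing_stanleyReisner {k : Type} [Field k] {s r : ℕ}
    {Δ : Finset (Fin s) → Prop} (h : IsMatroid Δ) (hr : ∀ F, IsBasisOf Δ F → F.card = r)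
    (N : Type) [AddCommGroup N] [Module (MvPolynomial (Fin s) k) N]
    (hN : ∀ l : List (Fin s), l.Nodup → l.length = s - r →
      RingTheory.Sequence.IsWeaklyRegular N (l.map (X : Fin s → MvPolynomial (Fin s) k))) :
    HigherVanishing (ModuleCat.of _ (MvPolynomial (Fin s) k ⧸ stanleyReisnerIdeal k Δ))
      (ModuleCat.of (MvPolynomial (Fin s) k) N) := by
  refine h.stanleyReisner_induction (r := r) (fun I => HigherVanishing (ModuleCat.of _
    (MvPolynomial (Fin s) k ⧸ I)) (ModuleCat.of (MvPolynomial (Fin s) k) N)) (fun T hT => ?_)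
    (fun I J K v hJ hK h₁ h₃ => HigherVanishing.of_colon (X v) hJ hK h₁ h₃) (fun F hF => ?_) ?_
  · have := higherVanishing_span_X N T.toList T.nodup_toList
      (hN _ T.nodup_toList (by simpa using hT))
    rwa [show {i | i ∈ T.toList} = (T : Set (Fin s)) by ext; simp] at this
  · obtain ⟨B, hB, hFB⟩ := exists_isBasisOf_superset hF
    exact hr B hB ▸ Finset.card_le_card hFB
  · obtain ⟨B, hB, -⟩ := exists_isBasisOf_superset h.1
    exact ⟨B, hB.1, hr B hB⟩

theorem statement11 (k : Type) [Field k] [Infinite k] (s c n : ℕ) (hcs : c ≤ s) (hcn : c ≤ n)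
    (Δ : Finset (Fin s) → Prop) (hmat : IsMatroid Δ)
    (hdim : ∀ F, IsBasisOf Δ F → F.card = s - c)
    (f : Fin s → MvPolynomial (Fin (n + 1)) k) (d : Fin s → ℕ)
    (hdeg : ∀ i, (f i).IsHomogeneous (d i))
    (hreg : SubsetsRegular f (c + 1)) :
    ∀ i : ℕ,
      bettiNum k (Ideal.map (MvPolynomial.aeval (R := k) f).toRingHom
        (stanleyReisnerIdeal k Δ)) i = bettiNum k (stanleyReisnerIdeal k Δ) i := by
  intro i
  let : Algebra (MvPolynomial (Fin s) k) (MvPolynomial (Fin (n + 1)) k) :=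
    (aeval (R := k) f).toRingHom.toAlgebra
  have : IsScalarTower k (MvPolynomial (Fin s) k) (MvPolynomial (Fin (n + 1)) k) :=
    IsScalarTower.of_algebraMap_eq fun a => ((aeval (R := k) f).commutes a).symm
  have hf : ∀ j, constantCoeff (f j) = 0 := fun j =>
    constantCoeff_eq_zero_of_isRegular (hdeg j) (hreg [j] (by simp) (by simp))
  have hvan := hmat.higherVanishing_stanleyReisner (k := k) hdim
    (MvPolynomial (Fin (n + 1)) k) fun l hl hlen => by
      rw [← RingTheory.Sequence.isWeaklyRegular_map_algebraMap_iff
        (MvPolynomial (Fin (n + 1)) k), List.map_map]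
      have hcomp : algebraMap (MvPolynomial (Fin s) k) (MvPolynomial (Fin (n + 1)) k) ∘ X = f :=
        _root_.funext fun j => aeval_X f j
      rw [hcomp]
      exact (hreg l hl (by omega)).toIsWeaklyRegular
  exact (TensorComplex.torRank_congr (Ideal.qoutMapEquivTensorQout _)
    (LinearEquiv.refl _ _) i).trans ((TensorComplex.torRank_baseChange _ _ hvan i).trans
    (TensorComplex.torRank_congr (LinearEquiv.refl _ _)
      (quotientIrrelevantIdealEquiv (constantCoeff_aeval hf)).symm i))
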